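/- Second-order output derivative of an input-affine system: let E be a real normed vector space, f₀, …, f_m : E → E differentiable, u₁, …, u_m : ℝ → ℝ differentiable, h : E → ℝ^k twice continuously differentiable, and x : ℝ → E such that for all t, ẋ(t) = f₀(x(t)) + Σ_{i=1}^m uᵢ(t)·fᵢ(x(t)). Then y = h∘x is twice differentiable and, writing u₀(t) ≡ 1 (so u̇₀ ≡ 0), ÿ(t) = Σ_{i=0}^m Σ_{j=0}^m L²_{fᵢ,fⱼ}h(x(t))·uᵢ(t)·uⱼ(t) + Σ_{i=0}^m L¹_{fᵢ}h(x(t))·u̇ᵢ(t); equivalently ÿ = L²_{f₀,f₀}h + Σᵢ L²_{f₀,fᵢ}h·uᵢ + Σᵢ L²_{fᵢ,f₀}h·uᵢ + Σᵢ Σⱼ L²_{fᵢ,fⱼ}h·uᵢ·uⱼ + Σᵢ L¹_{fᵢ}h·u̇ᵢ, with the single sums over i, j = 1, …, m. -/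

import Mathlib

/-- First-order Lie derivative of `h : E → F` along `f : E → E`:
`L¹_f h (x) = Dh(x)(f(x))`. -/
noncomputable def lieDeriv {E F : Type*} [NormedAddCommGroup E] [NormedSpace ℝ E]
    [NormedAddCommGroup F] [NormedSpace ℝ F] (f : E → E) (h : E → F) (x : E) : F :=
  fderiv ℝ h x (f x)

/-- Second-order Lie derivative: `L²_{f,g} h (x) = L¹_g (L¹_f h) (x) = D(L¹_f h)(x)(g(x))`. -/
noncomputable def lieDeriv2 {E F : Type*} [NormedAddCommGroup E] [NormedSpace ℝ E]
    [NormedAddCommGroup F] [NormedSpace ℝ F] (f g : E → E) (h : E → F) (x : E) : F :=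
  fderiv ℝ (lieDeriv f h) x (g x)

/-- The Lie derivative of a `C²` map along a differentiable vector field is differentiable. -/
theorem differentiable_lieDeriv {E F : Type*} [NormedAddCommGroup E] [NormedSpace ℝ E]
    [NormedAddCommGroup F] [NormedSpace ℝ F] {f : E → E} {h : E → F}
    (hf : Differentiable ℝ f) (hh : ContDiff ℝ 2 h) : Differentiable ℝ (lieDeriv f h) := by
  have hd : Differentiable ℝ (fderiv ℝ h) :=
    (hh.fderiv_right (m := 1) (by norm_num)).differentiable one_ne_zero
  exact hd.clm_apply hf

/-- Chain rule along a trajectory of an input-affine system. -/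
theorem hasDerivAt_comp_of_input_affine {ι E F : Type*} [Fintype ι]
    [NormedAddCommGroup E] [NormedSpace ℝ E] [NormedAddCommGroup F] [NormedSpace ℝ F]
    {f : ι → E → E} {u : ι → ℝ → ℝ} {g : E → F} {x : ℝ → E} {t : ℝ}
    (hg : DifferentiableAt ℝ g (x t))
    (hx : HasDerivAt x (∑ i, u i t • f i (x t)) t) :
    HasDerivAt (fun s => g (x s)) (∑ i, u i t • fderiv ℝ g (x t) (f i (x t))) t := by
  simpa only [map_sum, map_smul, Function.comp_def] using
    hg.hasFDerivAt.comp_hasDerivAt t hx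

/-- Second-order output derivative of an input-affine system.  Writing the system with the
index `0` for the drift term and the constant input `u₀ ≡ 1` (so `u̇₀ ≡ 0`), i.e.
`ẋ(t) = ∑_{i=0}^m uᵢ(t) • fᵢ(x(t))` with `u₀(t) = 1`, and assuming the `fᵢ` and `uᵢ`
differentiable and `h : E → ℝ^k` twice continuously differentiable, the output
`y = h ∘ x` is twice differentiable with
`ÿ(t) = ∑_{i=0}^m ∑_{j=0}^m L²_{fᵢ,fⱼ}h(x(t))·uᵢ(t)·uⱼ(t) + ∑_{i=0}^m L¹_{fᵢ}h(x(t))·u̇ᵢ(t)`. -/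
theorem output_second_deriv_input_affine
    {E : Type*} [NormedAddCommGroup E] [NormedSpace ℝ E]
    (m k : ℕ) (f : Fin (m + 1) → E → E) (u : Fin (m + 1) → ℝ → ℝ)
    (h : E → (Fin k → ℝ)) (x : ℝ → E)
    (hu0 : ∀ t : ℝ, u 0 t = 1)
    (hf : ∀ i, Differentiable ℝ (f i))
    (hu : ∀ i, Differentiable ℝ (u i))
    (hh : ContDiff ℝ 2 h)
    (hx : ∀ t : ℝ, HasDerivAt x (∑ i, u i t • f i (x t)) t) :
    ∀ t : ℝ,
      DifferentiableAt ℝ (fun s => h (x s)) t ∧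
      HasDerivAt (deriv (fun s => h (x s)))
        (∑ i, ∑ j, (u i t * u j t) • lieDeriv2 (f i) (f j) h (x t)
          + ∑ i, deriv (u i) t • lieDeriv (f i) h (x t)) t := by
  intro t
  have hy : ∀ s, HasDerivAt (fun r => h (x r)) (∑ i, u i s • lieDeriv (f i) h (x s)) s :=
    fun s => hasDerivAt_comp_of_input_affine (hh.differentiable two_ne_zero _) (hx s)
  refine ⟨(hy t).differentiableAt, ?_⟩
  rw [funext fun s => (hy s).deriv]
  have hterm : ∀ i ∈ Finset.univ, HasDerivAt (fun s => u i s • lieDeriv (f i) h (x s))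
      (u i t • ∑ j, u j t • lieDeriv2 (f i) (f j) h (x t)
        + deriv (u i) t • lieDeriv (f i) h (x t)) t := fun i _ =>
    (hu i t).hasDerivAt.fun_smul
      (hasDerivAt_comp_of_input_affine (differentiable_lieDeriv (hf i) hh _) (hx t))
  simpa only [Finset.sum_add_distrib, Finset.smul_sum, smul_smul] using HasDerivAt.fun_sum hterm
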